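/- Let K be a commutative ring and let T be a K-linear additive category in which idempotents split and such that the endomorphism ring of every object is left and right artinian. Then T is a Krull–Schmidt category: every object of T decomposes as a finite direct sum (biproduct) of objects whose endomorphism rings are local rings. -/

import Mathlib

open CategoryTheory CategoryTheory.Limits

/-- A nontrivial left artinian ring without nontrivial idempotents is local. -/
theorem IsArtinianRing.isLocalRing_of_isIdempotentElem {R : Type*} [Ring R] [Nontrivial R]
    [IsArtinianRing R] (h : ∀ e : R, IsIdempotentElem e → e = 0 ∨ e = 1) : IsLocalRing R := by
  refine .of_isUnit_or_isUnit_one_sub_self fun a ↦ ?_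
  -- Apply Fitting's lemma to right multiplication by `a`.
  obtain ⟨n, hc, hn⟩ := ((LinearMap.toSpanSingleton R R a).eventually_isCompl_ker_pow_range_pow.and
    (Filter.eventually_ne_atTop 0)).exists
  have hpow (m : ℕ) (x : R) : (LinearMap.toSpanSingleton R R a ^ m) x = x * a ^ m := by
    induction m generalizing x with
    | zero => simp
    | succ m ih =>
      rw [pow_succ, Module.End.mul_apply, ih, LinearMap.toSpanSingleton_apply, smul_eq_mul,
        mul_assoc, ← pow_succ']
  set f := LinearMap.toSpanSingleton R R a ^ n
  obtain ⟨x, hx, y, hy, hxy⟩ :=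
    Submodule.mem_sup.mp (hc.sup_eq_top ▸ Submodule.mem_top (x := (1 : R)))
  have hyx : y = 1 - x := eq_sub_of_add_eq' hxy
  have hmul : x * y = 0 := by
    refine Submodule.disjoint_def.mp hc.disjoint _ ?_ (Submodule.smul_mem _ x hy)
    rw [hyx, mul_sub, mul_one]
    exact sub_mem hx (Submodule.smul_mem _ x hx)
  have hidem : IsIdempotentElem x := by
    rw [hyx, mul_sub, mul_one, sub_eq_zero] at hmul
    exact hmul.symm
  rcases h x hidem with rfl | rfl
  · left
    obtain rfl : y = 1 := by simpa using hxy
    have hrange : LinearMap.range f = ⊤ := (Ideal.eq_top_iff_one _).mpr hy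
    have hker : LinearMap.ker f = ⊥ := by
      simpa [hrange] using hc.disjoint
    obtain ⟨b, hb⟩ := hy
    rw [hpow] at hb
    have hb' : a ^ n * b = 1 := by
      refine LinearMap.ker_eq_bot.mp hker ?_
      rw [hpow, hpow, mul_assoc, hb, mul_one, one_mul]
    exact (isUnit_pow_iff hn).mp ⟨⟨a ^ n, b, hb', hb⟩, rfl⟩
  · right
    refine IsNilpotent.isUnit_one_sub ⟨n, ?_⟩
    rw [LinearMap.mem_ker, hpow, one_mul] at hx
    exact hx

namespace CategoryTheory

variable {T : Type*} [Category T] [Preadditive T]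

/-- A splitting of complementary idempotents `p` and `𝟙 Y - p` exhibits `Y` as a biproduct. -/
def binaryBiconeOfSplitting {Y Y₁ Y₂ : T} {p : Y ⟶ Y} {i₁ : Y₁ ⟶ Y} {r₁ : Y ⟶ Y₁}
    {i₂ : Y₂ ⟶ Y} {r₂ : Y ⟶ Y₂} (h₁ : i₁ ≫ r₁ = 𝟙 Y₁) (hp₁ : r₁ ≫ i₁ = p)
    (h₂ : i₂ ≫ r₂ = 𝟙 Y₂) (hp₂ : r₂ ≫ i₂ = 𝟙 Y - p) : BinaryBicone Y₁ Y₂ where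
  pt := Y
  fst := r₁
  snd := r₂
  inl := i₁
  inr := i₂
  inl_fst := h₁
  inr_snd := h₂
  inl_snd := by
    have h : i₁ ≫ (r₂ ≫ i₂) = 0 := by
      rw [hp₂, ← hp₁, Preadditive.comp_sub, reassoc_of% h₁, Category.comp_id, sub_self]
    simpa [h₂] using h =≫ r₂
  inr_fst := by
    have h : i₂ ≫ (r₁ ≫ i₁) = 0 := by
      rw [hp₁, ← sub_sub_cancel (𝟙 Y) p, ← hp₂, Preadditive.comp_sub, reassoc_of% h₂,
        Category.comp_id, sub_self]
    simpa [h₁] using h =≫ r₁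

/-- If `Y` is a retract of `X`, split by `i` and `r`, then cutting `Y` down by an idempotent
`p ≠ 𝟙 Y` shrinks the corresponding left ideal of `End X`. -/
theorem span_comp_lt_span_of_splitting {X Y Z : T} {i : Y ⟶ X} {r : X ⟶ Y} (h : i ≫ r = 𝟙 Y)
    {p : Y ⟶ Y} (hp : p ≠ 𝟙 Y) {j : Z ⟶ Y} {s : Y ⟶ Z} (hj : j ≫ s = 𝟙 Z) (hs : s ≫ j = p) :
    Ideal.span (α := End X) {(r ≫ s) ≫ (j ≫ i)} < Ideal.span (α := End X) {r ≫ i} := by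
  refine lt_of_le_not_ge ?_ fun hle ↦ hp ?_
  · rw [Ideal.span_singleton_le_iff_mem, Ideal.mem_span_singleton']
    refine ⟨((r ≫ s) ≫ (j ≫ i) : X ⟶ X), ?_⟩
    rw [End.mul_def]
    simp [reassoc_of% h]
  · rw [Ideal.span_singleton_le_iff_mem, Ideal.mem_span_singleton'] at hle
    obtain ⟨g, hg⟩ := hle
    rw [End.mul_def] at hg
    have key : p ≫ (i ≫ g ≫ r) = 𝟙 Y := by
      have := i ≫= hg =≫ r
      simpa [reassoc_of% h, h, ← hs] using this
    have hpp : p ≫ p = p := by rw [← hs]; simp [reassoc_of% hj]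
    rw [← key, ← reassoc_of% hpp, key, Category.comp_id]

variable [HasFiniteBiproducts T]

/-- `X` is a finite biproduct of objects with local endomorphism rings. -/
def IsFiniteBiproductOfLocal (X : T) : Prop :=
  ∃ (n : ℕ) (f : Fin n → T), Nonempty (X ≅ ⨁ f) ∧ ∀ i : Fin n, IsLocalRing (End (f i))

namespace IsFiniteBiproductOfLocal

theorem of_isLocalRing {X : T} (h : IsLocalRing (End X)) : IsFiniteBiproductOfLocal X :=
  ⟨1, fun _ ↦ X, ⟨(biproductUniqueIso fun _ : Fin 1 ↦ X).symm⟩, fun _ ↦ h⟩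

theorem of_isZero {X : T} (h : IsZero X) : IsFiniteBiproductOfLocal X := by
  refine ⟨0, Fin.elim0, ⟨h.iso ?_⟩, fun i ↦ i.elim0⟩
  rw [IsZero.iff_id_eq_zero]
  ext i
  exact i.elim0

theorem of_iso_biproduct {J : Type} [Fintype J] {X : T} {Y : J → T} (e : X ≅ ⨁ Y)
    (h : ∀ j, IsFiniteBiproductOfLocal (Y j)) : IsFiniteBiproductOfLocal X := by
  choose n f e' hf using h
  let σ := Fintype.equivFin (Σ j, Fin (n j))
  refine ⟨_, fun i ↦ f (σ.symm i).1 (σ.symm i).2, ⟨?_⟩, fun i ↦ hf _ _⟩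
  exact e ≪≫ biproduct.mapIso (fun j ↦ (e' j).some) ≪≫ biproductBiproductIso _ _ ≪≫
    (biproduct.reindex σ.symm fun p : Σ j, Fin (n j) ↦ f p.1 p.2).symm

theorem of_isBilimit {X Y : T} (b : BinaryBicone X Y) (hb : b.IsBilimit)
    (hX : IsFiniteBiproductOfLocal X) (hY : IsFiniteBiproductOfLocal Y) :
    IsFiniteBiproductOfLocal b.pt :=
  of_iso_biproduct (biproduct.uniqueUpToIso _ (b.toBiconeIsBilimit.symm hb)) fun j ↦
    match j with
    | .left => hX
    | .right => hY

end IsFiniteBiproductOfLocal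

/-- The Krull–Schmidt property only needs left artinian endomorphism rings. -/
theorem isFiniteBiproductOfLocal_of_isArtinianRing_end [IsIdempotentComplete T]
    (hart : ∀ X : T, IsArtinianRing (End X)) (X : T) : IsFiniteBiproductOfLocal X := by
  have := hart X
  suffices ∀ (I : Ideal (End X)) (Y : T) (i : Y ⟶ X) (r : X ⟶ Y), i ≫ r = 𝟙 Y →
      Ideal.span (α := End X) {r ≫ i} = I → IsFiniteBiproductOfLocal Y from
    this _ X (𝟙 X) (𝟙 X) (Category.comp_id _) rfl
  intro I
  induction I using WellFoundedLT.induction with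
  | ind I ih =>
    rintro Y i r h rfl
    have := hart Y
    rcases subsingleton_or_nontrivial (End Y) with hY | hY
    · exact .of_isZero ((IsZero.iff_id_eq_zero Y).mpr (hY.elim _ _))
    by_cases hloc : ∀ p : End Y, IsIdempotentElem p → p = 0 ∨ p = 1
    · exact .of_isLocalRing (IsArtinianRing.isLocalRing_of_isIdempotentElem hloc)
    push Not at hloc
    obtain ⟨p, hp, hp0, hp1⟩ : ∃ p : Y ⟶ Y, p ≫ p = p ∧ p ≠ 0 ∧ p ≠ 𝟙 Y := hloc
    obtain ⟨Y₁, i₁, r₁, h₁, hp₁⟩ := IsIdempotentComplete.idempotents_split Y p hp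
    obtain ⟨Y₂, i₂, r₂, h₂, hp₂⟩ := IsIdempotentComplete.idempotents_split Y (𝟙 Y - p)
      (by simp [hp])
    refine .of_isBilimit (binaryBiconeOfSplitting h₁ hp₁ h₂ hp₂)
      (isBinaryBilimitOfTotal _ ?_) ?_ ?_
    · change r₁ ≫ i₁ + r₂ ≫ i₂ = 𝟙 Y
      rw [hp₁, hp₂, add_sub_cancel]
    · exact ih _ (span_comp_lt_span_of_splitting h hp1 h₁ hp₁) _ (i₁ ≫ i) (r ≫ r₁)
        (by simp [reassoc_of% h, h₁]) rfl
    · refine ih _ (span_comp_lt_span_of_splitting h ?_ h₂ hp₂) _ (i₂ ≫ i) (r ≫ r₂)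
        (by simp [reassoc_of% h, h₂]) rfl
      exact fun hp' ↦ hp0 (sub_eq_self.mp hp')

end CategoryTheory

/-- **Theorem (Krull–Schmidt property).** A `K`-linear additive category with split idempotents
whose endomorphism rings are all left and right artinian is a Krull–Schmidt category: every
object is a finite biproduct of objects with local endomorphism rings. -/
theorem krullSchmidt_of_artinian_endomorphism_rings
    (K : Type*) [CommRing K]
    (T : Type*) [Category T] [Preadditive T] [Linear K T] [HasFiniteBiproducts T]
    [IsIdempotentComplete T]
    (hart : ∀ X : T, IsArtinianRing (End X) ∧ IsArtinianRing (End X)ᵐᵒᵖ) :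
    ∀ X : T, ∃ (n : ℕ) (f : Fin n → T),
      Nonempty (X ≅ ⨁ f) ∧ ∀ i : Fin n, IsLocalRing (End (f i)) := by
  exact isFiniteBiproductOfLocal_of_isArtinianRing_end fun X ↦ (hart X).1
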